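/- Let λ > 0, θ ∈ (−π/2, π/2) with θ ≠ 0, μ = tan θ, and u_{1s}, u_{2s} ∈ ℝ with u_{2s} − μ·u_{1s} > 0. Apply the lower-wall reflection map (v₁, v₂) ↦ (v₁cos 2θ + v₂sin 2θ, v₁sin 2θ − v₂cos 2θ) to the velocity (v̂₁, v̂₂) = (0, −λ(u_{2s} − μu_{1s})) of the unstable separatrix of P at its impact point. The first component of the image equals −2μλ(u_{2s} − μu_{1s})/(1 + μ²), which is nonzero. Hence, for θ ≠ 0, the reflected unstable separatrix does not coincide with the stable separatrix (whose intersection with the wall has v₁ = 0): the lower branches of the separatrices of P are split. -/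

import Mathlib

/-- For a slanted lower wall (`θ ≠ 0`, `μ = tan θ`), applying the reflection
map `(v₁, v₂) ↦ (v₁ cos 2θ + v₂ sin 2θ, v₁ sin 2θ − v₂ cos 2θ)` to the impact
velocity `(0, −λ(u_{2s} − μ u_{1s}))` of the unstable separatrix of `P` yields
a first component equal to `−2μλ(u_{2s} − μu_{1s})/(1 + μ²) ≠ 0`; hence the
reflected unstable separatrix does not coincide with the stable separatrix
(whose wall intersection has `v₁ = 0`): the lower separatrix branches split. -/
theorem separatrix_splitting_for_slanted_wall
    (lam θ u1s u2s μ : ℝ) (hlam : 0 < lam)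
    (hθ : θ ∈ Set.Ioo (-(Real.pi / 2)) (Real.pi / 2)) (hθ0 : θ ≠ 0)
    (hμ : μ = Real.tan θ) (hpos : 0 < u2s - μ * u1s) :
    ((0 : ℝ) * Real.cos (2 * θ) +
        (-(lam * (u2s - μ * u1s))) * Real.sin (2 * θ) =
      -(2 * μ * lam * (u2s - μ * u1s)) / (1 + μ ^ 2)) ∧
      -(2 * μ * lam * (u2s - μ * u1s)) / (1 + μ ^ 2) ≠ 0 := by
  have hcos : 0 < Real.cos θ := Real.cos_pos_of_mem_Ioo hθ
  have hμ0 : μ ≠ 0 := by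
    rw [hμ, ← Real.tan_zero]
    refine fun h => hθ0 (Real.injOn_tan hθ ?_ h)
    constructor <;> linarith [Real.pi_pos]
  have hden : 1 + μ ^ 2 ≠ 0 := by positivity
  refine ⟨?_, div_ne_zero (neg_ne_zero.mpr ?_) hden⟩
  · have hsin : Real.sin θ = μ * Real.cos θ := by
      rw [hμ, Real.tan_mul_cos hcos.ne']
    have hsq : (1 + μ ^ 2) * Real.cos θ ^ 2 = 1 := by
      have h := Real.sin_sq_add_cos_sq θ
      rw [hsin] at h
      linarith
    rw [eq_div_iff hden, Real.sin_two_mul, hsin]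
    linear_combination -(2 * μ * lam * (u2s - μ * u1s)) * hsq
  · exact mul_ne_zero (mul_ne_zero (mul_ne_zero two_ne_zero hμ0) hlam.ne') hpos.ne'
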